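/- Let K ⊆ ℝ^d be a finite set spanning ℝ^d, let Z ⊆ ℝ^d be a finite nonempty set, let ε ≥ 0, and let μ ∈ ℝ^d. Assume ¬_ε z is nonempty for every z ∈ Z, and assume the furthest-answer set z_F(μ) is a singleton. Then there exists an open neighborhood U of μ in ℝ^d such that z_F(λ) = z_F(μ) for every λ ∈ U. -/

import Mathlib

open Matrix

noncomputable section

/-- The additive `ε`-optimal answers `Z_ε(μ)`. -/
def epsOpt {d : ℕ} (Z : Finset (Fin d → ℝ)) (ε : ℝ) (μ : Fin d → ℝ) :
    Set (Fin d → ℝ) :=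
  {z | z ∈ Z ∧ ∀ x ∈ Z, μ ⬝ᵥ x - ε ≤ μ ⬝ᵥ z}

/-- The alternative `¬_ε z`. -/
def altSet {d : ℕ} (Z : Finset (Fin d → ℝ)) (ε : ℝ) (z : Fin d → ℝ) :
    Set (Fin d → ℝ) :=
  closure {lam | z ∉ epsOpt Z ε lam}

/-- The design matrix `V_w = ∑_{a∈K} w(a)·a aᵀ`. -/
def designMat {d : ℕ} (K : Finset (Fin d → ℝ)) (w : (Fin d → ℝ) → ℝ) :
    Matrix (Fin d) (Fin d) ℝ :=
  ∑ a ∈ K, w a • vecMulVec a a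

/-- The probability simplex `Δ_K` over the arms `K`. -/
def simplexK {d : ℕ} (K : Finset (Fin d → ℝ)) : Set ((Fin d → ℝ) → ℝ) :=
  {w | (∀ a, 0 ≤ w a) ∧ ∑ a ∈ K, w a = 1}

/-- `g_μ(z) = sup_{w∈Δ_K} inf_{λ∈¬_ε z} (1/2)‖μ-λ‖²_{V_w}`. -/
def gval {d : ℕ} (K Z : Finset (Fin d → ℝ)) (ε : ℝ) (μ z : Fin d → ℝ) : ℝ :=
  sSup ((fun w =>
      sInf ((fun lam => (1 / 2) * ((μ - lam) ⬝ᵥ (designMat K w).mulVec (μ - lam))) ''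
        altSet Z ε z)) '' simplexK K)

/-- The furthest answers `z_F(μ)`: maximizers of `g_μ` over `Z_ε(μ)`. -/
def zF {d : ℕ} (K Z : Finset (Fin d → ℝ)) (ε : ℝ) (μ : Fin d → ℝ) :
    Set (Fin d → ℝ) :=
  {z ∈ epsOpt Z ε μ | ∀ z' ∈ epsOpt Z ε μ, gval K Z ε μ z' ≤ gval K Z ε μ z}

lemma quad_eq {d : ℕ} (K : Finset (Fin d → ℝ)) (w : (Fin d → ℝ) → ℝ) (h : Fin d → ℝ) :
    h ⬝ᵥ (designMat K w).mulVec h = ∑ a ∈ K, w a * (a ⬝ᵥ h) ^ 2 := by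
  unfold designMat
  rw [Matrix.sum_mulVec, dotProduct_sum]
  refine Finset.sum_congr rfl fun a _ => ?_
  rw [Matrix.smul_mulVec, dotProduct_smul, Matrix.vecMulVec_mulVec]
  simp only [op_smul_eq_smul, dotProduct_smul, smul_eq_mul]
  rw [dotProduct_comm h a]
  ring

lemma quad_nonneg {d : ℕ} (K : Finset (Fin d → ℝ)) (w : (Fin d → ℝ) → ℝ)
    (hw : w ∈ simplexK K) (h : Fin d → ℝ) :
    0 ≤ h ⬝ᵥ (designMat K w).mulVec h := by
  rw [quad_eq]
  exact Finset.sum_nonneg fun a _ => mul_nonneg (hw.1 a) (sq_nonneg _)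

/-- A bound on all the quadratic forms, uniform over the simplex. -/
def unifB {d : ℕ} (K : Finset (Fin d → ℝ)) (h : Fin d → ℝ) : ℝ :=
  ∑ a ∈ K, (a ⬝ᵥ h) ^ 2

lemma unifB_nonneg {d : ℕ} (K : Finset (Fin d → ℝ)) (h : Fin d → ℝ) : 0 ≤ unifB K h :=
  Finset.sum_nonneg fun _ _ => sq_nonneg _

lemma quad_le {d : ℕ} (K : Finset (Fin d → ℝ)) (w : (Fin d → ℝ) → ℝ)
    (hw : w ∈ simplexK K) (h : Fin d → ℝ) :
    h ⬝ᵥ (designMat K w).mulVec h ≤ unifB K h := by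
  rw [quad_eq]
  refine Finset.sum_le_sum fun a ha => ?_
  have h1 : w a ≤ 1 := hw.2 ▸ Finset.single_le_sum (fun b _ => hw.1 b) ha
  exact mul_le_of_le_one_left (sq_nonneg _) h1

lemma quad_add {d : ℕ} (K : Finset (Fin d → ℝ)) (w : (Fin d → ℝ) → ℝ)
    (hw : w ∈ simplexK K) (x h : Fin d → ℝ) (t : ℝ) (ht : 0 < t) :
    (x + h) ⬝ᵥ (designMat K w).mulVec (x + h) ≤
      (1 + t) * (x ⬝ᵥ (designMat K w).mulVec x) +
      (1 + t⁻¹) * (h ⬝ᵥ (designMat K w).mulVec h) := by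
  simp only [quad_eq]
  rw [Finset.mul_sum, Finset.mul_sum, ← Finset.sum_add_distrib]
  refine Finset.sum_le_sum fun a _ => ?_
  rw [dotProduct_add]
  generalize a ⬝ᵥ x = p
  generalize a ⬝ᵥ h = q
  have key : (p + q) ^ 2 ≤ (1 + t) * p ^ 2 + (1 + t⁻¹) * q ^ 2 := by
    have h0 : 0 ≤ t⁻¹ * (t * p - q) ^ 2 := by positivity
    have h1 : t⁻¹ * (t * p - q) ^ 2 = t * p ^ 2 - 2 * p * q + t⁻¹ * q ^ 2 := by
      field_simp
      ring
    nlinarith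
  nlinarith [mul_le_mul_of_nonneg_left key (hw.1 a)]

lemma inner_bddBelow {d : ℕ} (K Z : Finset (Fin d → ℝ)) (ε : ℝ) (μ z : Fin d → ℝ)
    (w : (Fin d → ℝ) → ℝ) (hw : w ∈ simplexK K) :
    BddBelow ((fun lam => (1 / 2) * ((μ - lam) ⬝ᵥ (designMat K w).mulVec (μ - lam))) ''
        altSet Z ε z) := by
  refine ⟨0, ?_⟩
  rintro _ ⟨lam, _, rfl⟩
  have := quad_nonneg K w hw (μ - lam)
  dsimp only
  linarith

lemma inner_nonneg' {d : ℕ} (K Z : Finset (Fin d → ℝ)) (ε : ℝ) (μ z : Fin d → ℝ)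
    (w : (Fin d → ℝ) → ℝ) (hw : w ∈ simplexK K) :
    0 ≤ sInf ((fun lam => (1 / 2) * ((μ - lam) ⬝ᵥ (designMat K w).mulVec (μ - lam))) ''
        altSet Z ε z) := by
  refine Real.sInf_nonneg ?_
  rintro _ ⟨lam, _, rfl⟩
  have := quad_nonneg K w hw (μ - lam)
  dsimp only
  linarith

lemma gval_nonneg {d : ℕ} (K Z : Finset (Fin d → ℝ)) (ε : ℝ) (μ z : Fin d → ℝ) :
    0 ≤ gval K Z ε μ z := by
  refine Real.sSup_nonneg ?_
  rintro _ ⟨w, hw, rfl⟩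
  exact inner_nonneg' K Z ε μ z w hw

lemma le_gval {d : ℕ} (K Z : Finset (Fin d → ℝ)) (ε : ℝ) (μ z : Fin d → ℝ)
    (hne : (altSet Z ε z).Nonempty)
    (w : (Fin d → ℝ) → ℝ) (hw : w ∈ simplexK K) :
    sInf ((fun lam => (1 / 2) * ((μ - lam) ⬝ᵥ (designMat K w).mulVec (μ - lam))) ''
        altSet Z ε z) ≤ gval K Z ε μ z := by
  obtain ⟨l, hl⟩ := hne
  refine le_csSup ⟨(1 / 2) * unifB K (μ - l), ?_⟩ ⟨w, hw, rfl⟩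
  rintro _ ⟨v, hv, rfl⟩
  refine (csInf_le (inner_bddBelow K Z ε μ z v hv) ⟨l, hl, rfl⟩).trans ?_
  have := quad_le K v hv (μ - l)
  dsimp only
  linarith

lemma gval_perturb {d : ℕ} (K Z : Finset (Fin d → ℝ)) (ε : ℝ) (μ lam z : Fin d → ℝ)
    (hne : (altSet Z ε z).Nonempty) (t : ℝ) (ht : 0 < t) :
    gval K Z ε lam z ≤ (1 + t) * gval K Z ε μ z + (1 + t⁻¹) * unifB K (lam - μ) := by
  have hB := unifB_nonneg K (lam - μ)
  have ht' : 0 < t⁻¹ := inv_pos.mpr ht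
  refine Real.sSup_le ?_ ?_
  · rintro _ ⟨w, hw, rfl⟩
    have h1 := le_gval K Z ε μ z hne w hw
    set I := sInf ((fun l => (1 / 2) * ((μ - l) ⬝ᵥ (designMat K w).mulVec (μ - l))) ''
        altSet Z ε z) with hI
    dsimp only
    set J := sInf ((fun l => (1 / 2) * ((lam - l) ⬝ᵥ (designMat K w).mulVec (lam - l))) ''
        altSet Z ε z) with hJ
    have h2 : (J - (1 + t⁻¹) * unifB K (lam - μ)) / (1 + t) ≤ I := by
      refine le_csInf (hne.image _) ?_
      rintro _ ⟨l, hl, rfl⟩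
      rw [div_le_iff₀ (by linarith)]
      have h3 : J ≤ (1 / 2) * ((lam - l) ⬝ᵥ (designMat K w).mulVec (lam - l)) :=
        csInf_le (inner_bddBelow K Z ε lam z w hw) ⟨l, hl, rfl⟩
      have h4 := quad_add K w hw (μ - l) (lam - μ) t ht
      rw [show μ - l + (lam - μ) = lam - l by abel] at h4
      have h5 := quad_le K w hw (lam - μ)
      have h6 := mul_le_mul_of_nonneg_left h5 (by linarith : (0 : ℝ) ≤ 1 + t⁻¹)
      have h7 : 0 ≤ (1 + t⁻¹) * unifB K (lam - μ) := by positivity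
      dsimp only
      linarith
    rw [div_le_iff₀ (by linarith)] at h2
    nlinarith
  · have := gval_nonneg K Z ε μ z
    positivity

lemma gval_tendsto {d : ℕ} (K Z : Finset (Fin d → ℝ)) (ε : ℝ) (μ z : Fin d → ℝ)
    (hne : (altSet Z ε z).Nonempty) :
    ContinuousAt (fun lam => gval K Z ε lam z) μ := by
  have hg := gval_nonneg K Z ε μ z
  refine tendsto_order.2 ⟨fun c hc => ?_, fun c hc => ?_⟩
  · obtain ⟨t, ht, htc⟩ : ∃ t : ℝ, 0 < t ∧ (1 + t) * c < gval K Z ε μ z := by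
      have hcont : ContinuousAt (fun t : ℝ => (1 + t) * c) 0 := by fun_prop
      have := hcont.eventually_lt_const (u := gval K Z ε μ z) (by simpa using hc)
      obtain ⟨t, h1, h2⟩ := ((this.filter_mono nhdsWithin_le_nhds).and
        (self_mem_nhdsWithin (s := Set.Ioi (0 : ℝ)))).exists
      exact ⟨t, h2, h1⟩
    have hcont : ContinuousAt (fun lam => (1 + t) * c + (1 + t⁻¹) * unifB K (μ - lam)) μ := by
      unfold unifB dotProduct
      refine Continuous.continuousAt ?_
      fun_prop
    have := hcont.eventually_lt_const (u := gval K Z ε μ z) (by simpa [unifB] using htc)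
    filter_upwards [this] with lam hl
    have h1 := gval_perturb K Z ε lam μ z hne t ht
    have h2 : (1 + t) * c < (1 + t) * gval K Z ε lam z := by linarith
    exact lt_of_mul_lt_mul_left h2 (by linarith)
  · obtain ⟨t, ht, htc⟩ : ∃ t : ℝ, 0 < t ∧ (1 + t) * gval K Z ε μ z < c := by
      have hcont : ContinuousAt (fun t : ℝ => (1 + t) * gval K Z ε μ z) 0 := by fun_prop
      have := hcont.eventually_lt_const (u := c) (by simpa using hc)
      obtain ⟨t, h1, h2⟩ := ((this.filter_mono nhdsWithin_le_nhds).and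
        (self_mem_nhdsWithin (s := Set.Ioi (0 : ℝ)))).exists
      exact ⟨t, h2, h1⟩
    have hcont : ContinuousAt
        (fun lam => (1 + t) * gval K Z ε μ z + (1 + t⁻¹) * unifB K (lam - μ)) μ := by
      unfold unifB dotProduct
      refine Continuous.continuousAt ?_
      fun_prop
    have := hcont.eventually_lt_const (u := c) (by simpa [unifB] using htc)
    filter_upwards [this] with lam hl
    exact (gval_perturb K Z ε μ lam z hne t ht).trans_lt hl

lemma epsOpt_usc {d : ℕ} (Z : Finset (Fin d → ℝ)) (ε : ℝ) (μ : Fin d → ℝ) :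
    ∀ᶠ lam in nhds μ, ∀ z ∈ Z, z ∈ epsOpt Z ε lam → z ∈ epsOpt Z ε μ := by
  rw [Filter.eventually_all_finset]
  intro z hz
  by_cases h : z ∈ epsOpt Z ε μ
  · exact Filter.Eventually.of_forall fun _ _ => h
  · have : ∃ x ∈ Z, μ ⬝ᵥ z < μ ⬝ᵥ x - ε := by
      by_contra! hc
      exact h ⟨hz, hc⟩
    obtain ⟨x, hx, hlt⟩ := this
    have h1 : ContinuousAt (fun lam : Fin d → ℝ => lam ⬝ᵥ z) μ := by
      unfold dotProduct
      refine Continuous.continuousAt ?_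
      fun_prop
    have h2 : ContinuousAt (fun lam : Fin d → ℝ => lam ⬝ᵥ x - ε) μ := by
      unfold dotProduct
      refine Continuous.continuousAt ?_
      fun_prop
    filter_upwards [h1.eventually_lt h2 hlt] with lam hl hmem
    exact absurd (hmem.2 x hx) (not_le.2 hl)

lemma epsOpt_nonempty {d : ℕ} (Z : Finset (Fin d → ℝ)) (hZ : Z.Nonempty) (ε : ℝ) (hε : 0 ≤ ε)
    (μ : Fin d → ℝ) : (epsOpt Z ε μ).Nonempty := by
  obtain ⟨z, hz, hmax⟩ := Z.exists_max_image (fun x => μ ⬝ᵥ x) hZ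
  exact ⟨z, hz, fun x hx => by have := hmax x hx; linarith⟩

lemma gval_eq_zero {d : ℕ} (K Z : Finset (Fin d → ℝ)) (ε : ℝ) (μ z : Fin d → ℝ)
    (h : μ ∈ altSet Z ε z) : gval K Z ε μ z ≤ 0 := by
  refine Real.sSup_le ?_ le_rfl
  rintro _ ⟨w, hw, rfl⟩
  exact csInf_le (inner_bddBelow K Z ε μ z w hw) ⟨μ, h, by simp⟩

/-- If the furthest-answer set at `μ` is a singleton, then `z_F` is
locally constant at `μ`: there is an open neighborhood `U` of `μ` on which
`z_F(λ) = z_F(μ)`. -/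
theorem stmt11 {d : ℕ} (K Z : Finset (Fin d → ℝ)) (hZ : Z.Nonempty)
    (hspan : Submodule.span ℝ (K : Set (Fin d → ℝ)) = ⊤)
    (ε : ℝ) (hε : 0 ≤ ε) (μ : Fin d → ℝ)
    (halt : ∀ z ∈ Z, (altSet Z ε z).Nonempty)
    (hsing : ∃ z₀, zF K Z ε μ = {z₀}) :
    ∃ U : Set (Fin d → ℝ), IsOpen U ∧ μ ∈ U ∧
      ∀ lam ∈ U, zF K Z ε lam = zF K Z ε μ := by
  obtain ⟨z₀, hz₀⟩ := hsing
  have hz₀mem : z₀ ∈ zF K Z ε μ := by rw [hz₀]; rfl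
  have hstrict : ∀ z ∈ epsOpt Z ε μ, z ≠ z₀ → gval K Z ε μ z < gval K Z ε μ z₀ := by
    intro z hz hne
    by_contra! hc
    have : z ∈ zF K Z ε μ := ⟨hz, fun z' hz' => (hz₀mem.2 z' hz').trans hc⟩
    rw [hz₀] at this
    exact hne this
  -- near `μ`, the answer `z₀` remains `ε`-optimal
  have hopt : ∀ᶠ lam in nhds μ, z₀ ∈ epsOpt Z ε lam := by
    by_cases hmem : μ ∈ altSet Z ε z₀
    · filter_upwards [epsOpt_usc Z ε μ] with lam hl
      obtain ⟨z, hz⟩ := epsOpt_nonempty Z hZ ε hε lam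
      by_cases hzz : z = z₀
      · exact hzz ▸ hz
      · have h1 := hstrict z (hl z hz.1 hz) hzz
        have h2 := gval_eq_zero K Z ε μ z₀ hmem
        have h3 := gval_nonneg K Z ε μ z
        linarith
    · have : (altSet Z ε z₀)ᶜ ∈ nhds μ := isClosed_closure.isOpen_compl.mem_nhds hmem
      filter_upwards [this] with lam hl
      by_contra hc
      exact hl (subset_closure hc)
  have hcmp : ∀ᶠ lam in nhds μ, ∀ z ∈ Z, z ∈ epsOpt Z ε μ → z ≠ z₀ →
      gval K Z ε lam z < gval K Z ε lam z₀ := by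
    rw [Filter.eventually_all_finset]
    intro z hz
    by_cases h : z ∈ epsOpt Z ε μ ∧ z ≠ z₀
    · filter_upwards [(gval_tendsto K Z ε μ z (halt z hz)).eventually_lt
        (gval_tendsto K Z ε μ z₀ (halt z₀ hz₀mem.1.1)) (hstrict z h.1 h.2)] with lam hl _ _
      exact hl
    · exact Filter.Eventually.of_forall fun _ h1 h2 => absurd ⟨h1, h2⟩ h
  obtain ⟨U, hU, hUo, hμU⟩ :=
    eventually_nhds_iff.1 (hopt.and (hcmp.and (epsOpt_usc Z ε μ)))
  refine ⟨U, hUo, hμU, fun lam hlam => ?_⟩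
  obtain ⟨h1, h2, h3⟩ := hU lam hlam
  rw [hz₀]
  ext z
  rw [Set.mem_singleton_iff]
  constructor
  · intro hz
    by_contra hne
    exact absurd (hz.2 z₀ h1) (not_le.2 (h2 z hz.1.1 (h3 z hz.1.1 hz.1) hne))
  · rintro rfl
    refine ⟨h1, fun z' hz' => ?_⟩
    by_cases hzz : z' = z
    · rw [hzz]
    · exact (h2 z' hz'.1 (h3 z' hz'.1 hz') hzz).le

end
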